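/- Let γ > 0, μ > 0 and define the weight w(q) = 1 + (1+|q|)^{1+2γ} for q > 0 and w(q) = 1 + (1+|q|)^{-2μ} for q < 0, where q = |x| - t. Then for any -1 ≤ a ≤ 1, any t ≥ 0 and any φ ∈ C_0^∞(ℝ³): ∫_{ℝ³} |φ(x)|²(1+|q|)^{-2}(1+t+|q|)^{-(1-a)} w(q) dx ≤ C ∫_{ℝ³} |∇φ(x)|²(1+t+|q|)^{-(1-a)} w(q) dx, with C depending only on γ, μ, a. -/

import Mathlib

open Real MeasureTheory

lemma lc_polar_nonneg (D : EuclideanSpace ℝ (Fin 3) → ℝ)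
    (h : ∀ ω : EuclideanSpace ℝ (Fin 3), ‖ω‖ = 1 →
      0 ≤ ∫ r in Set.Ioi (0:ℝ), r ^ 2 * D (r • ω)) : 0 ≤ ∫ x, D x := by
  have e1 : ∫ x, D x = ∫ x : ({(0)}ᶜ : Set (EuclideanSpace ℝ (Fin 3))), D x.1
      ∂((volume : Measure (EuclideanSpace ℝ (Fin 3))).comap (↑)) := by
    rw [integral_subtype_comap (measurableSet_singleton _).compl fun x ↦ D x,
        restrict_compl_singleton]
  have e2 : ∫ x : ({(0)}ᶜ : Set (EuclideanSpace ℝ (Fin 3))), D x.1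
      ∂((volume : Measure (EuclideanSpace ℝ (Fin 3))).comap (↑)) =
      ∫ p : (Metric.sphere (0 : EuclideanSpace ℝ (Fin 3)) 1) × (Set.Ioi (0:ℝ)),
        D (p.2.1 • p.1.1) ∂((volume : Measure (EuclideanSpace ℝ (Fin 3))).toSphere.prod
          (.volumeIoiPow (Module.finrank ℝ (EuclideanSpace ℝ (Fin 3)) - 1))) := by
    rw [← ((volume : Measure (EuclideanSpace ℝ (Fin 3))).measurePreserving_homeomorphUnitSphereProd).integral_comp
        (Homeomorph.measurableEmbedding _)]
    refine integral_congr_ae (.of_forall fun x => ?_)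
    have hx : ‖x.1‖ ≠ 0 := norm_ne_zero_iff.2 x.2
    simp [smul_smul, hx]
  rw [e1, e2]
  by_cases hi : Integrable (fun p : (Metric.sphere (0 : EuclideanSpace ℝ (Fin 3)) 1) × (Set.Ioi (0:ℝ)) =>
        D (p.2.1 • p.1.1)) ((volume : Measure (EuclideanSpace ℝ (Fin 3))).toSphere.prod
          (.volumeIoiPow (Module.finrank ℝ (EuclideanSpace ℝ (Fin 3)) - 1)))
  · rw [integral_prod _ hi]
    refine integral_nonneg fun ω => ?_
    have hω := h ω.1 (by simpa using ω.2)
    refine hω.trans_eq ?_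
    simp only [Measure.volumeIoiPow, ENNReal.ofReal]
    rw [integral_withDensity_eq_integral_smul,
        integral_subtype_comap measurableSet_Ioi fun a ↦ Real.toNNReal (a ^ (Module.finrank ℝ (EuclideanSpace ℝ (Fin 3)) - 1)) • D (a • ω.1),
        setIntegral_congr_fun measurableSet_Ioi fun x hx ↦ ?_]
    · have hx' : (0:ℝ) < x := hx
      rw [NNReal.smul_def, Real.coe_toNNReal _ (pow_nonneg hx'.le _)]
      simp
    · exact (measurable_subtype_coe.pow_const _).real_toNNReal
  · rw [integral_undef hi]

/-- the weight -/
noncomputable def lcW (γ μ a t r : ℝ) : ℝ :=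
  (1 + t + |r - t|) ^ (-(1 - a)) *
    (if 0 < r - t then 1 + (1 + |r - t|) ^ (1 + 2*γ) else 1 + (1 + |r - t|) ^ (-(2*μ)))

lemma lcW_cont (γ μ a t : ℝ) (ht : 0 ≤ t) : Continuous (lcW γ μ a t) := by
  unfold lcW
  have h1 : Continuous fun r : ℝ => |r - t| := by fun_prop
  have hp : ∀ r : ℝ, 0 ≤ |r - t| := fun r => abs_nonneg _
  refine Continuous.mul ?_ ?_
  · exact (by fun_prop : Continuous fun r : ℝ => 1 + t + |r - t|).rpow_const fun r => Or.inl (by have := hp r; positivity)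
  · refine Continuous.if ?_ ?_ ?_
    · intro r hr
      have : r = t := by
        have : frontier {r : ℝ | 0 < r - t} = {t} := by
          have : {r : ℝ | 0 < r - t} = Set.Ioi t := by ext; simp
          rw [this, frontier_Ioi]
        rw [this] at hr; exact hr
      simp [this]
    · exact continuous_const.add ((by fun_prop : Continuous fun r : ℝ => 1 + |r - t|).rpow_const fun r => Or.inl (by have := hp r; positivity))
    · exact continuous_const.add ((by fun_prop : Continuous fun r : ℝ => 1 + |r - t|).rpow_const fun r => Or.inl (by have := hp r; positivity))

lemma lcW_nonneg (γ μ a t r : ℝ) (ht : 0 ≤ t) : 0 ≤ lcW γ μ a t r := by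
  unfold lcW
  have := abs_nonneg (r - t)
  split_ifs <;> positivity

noncomputable def lcH (γ a t r : ℝ) : ℝ :=
  if r < t then r ^ 2 * (1 + t) ^ (-(1 - a)) / (1 + t - r)
  else r ^ 2 * (1 + r) ^ (-(1 - a)) * (1 + (r - t)) ^ (2 * γ)

lemma lc_left (γ μ a t r : ℝ) (hμ : 0 < μ) (ha1 : -1 ≤ a) (ha2 : a ≤ 1) (hr : 0 < r) (hrt : r < t) :
    (∃ d, HasDerivAt (fun r => r ^ 2 * (1 + t) ^ (-(1 - a)) / (1 + t - r)) d r ∧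
      (1 / 2) * (r ^ 2 * lcW γ μ a t r) / (1 + |r - t|) ^ 2 ≤ d) ∧
    r ^ 2 * (1 + t) ^ (-(1 - a)) / (1 + t - r) ≤ 4 * (r ^ 2 * lcW γ μ a t r) / (1 + |r - t|) := by
  have habs : |r - t| = t - r := by rw [abs_of_neg (by linarith)]; ring
  have hM : 0 < (1 + t) ^ (-(1 - a)) := by apply rpow_pos_of_pos; linarith
  have hw0 : 0 < (1 + (t - r)) ^ (-(2*μ)) := by apply rpow_pos_of_pos; linarith
  have hw1 : (1 + (t - r)) ^ (-(2*μ)) ≤ 1 :=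
    rpow_le_one_of_one_le_of_nonpos (by linarith) (by linarith)
  have hU : (1 + t + (t - r)) ^ (-(1 - a)) ≤ (1 + t) ^ (-(1 - a)) :=
    rpow_le_rpow_of_nonpos (by linarith) (by linarith) (by linarith)
  have hL : (1 + t) ^ (-(1 - a)) ≤ 4 * (1 + t + (t - r)) ^ (-(1 - a)) := by
    have h1 : (2 * (1 + t)) ^ (-(1 - a)) ≤ (1 + t + (t - r)) ^ (-(1 - a)) :=
      rpow_le_rpow_of_nonpos (by linarith) (by linarith) (by linarith)
    rw [mul_rpow (by norm_num) (by linarith)] at h1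
    have h2 : (2:ℝ) ^ (-(2:ℝ)) ≤ 2 ^ (-(1 - a)) :=
      rpow_le_rpow_of_exponent_le (by norm_num) (by linarith)
    have h3 : (2:ℝ) ^ (-(2:ℝ)) = 1 / 4 := by
      rw [rpow_neg (by norm_num)]; norm_num
    rw [h3] at h2
    nlinarith
  have hW : lcW γ μ a t r = (1 + t + (t - r)) ^ (-(1 - a)) * (1 + (1 + (t - r)) ^ (-(2*μ))) := by
    unfold lcW
    rw [if_neg (by linarith), habs]
  rw [hW, habs]
  set M := (1 + t) ^ (-(1 - a))
  set P := (1 + t + (t - r)) ^ (-(1 - a))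
  set w := (1 + (t - r)) ^ (-(2*μ))
  have hs : 0 < 1 + (t - r) := by linarith
  have e : 1 + t - r = 1 + (t - r) := by ring
  have hP : 0 < P := by linarith
  refine ⟨⟨2 * r * M / (1 + (t - r)) + r ^ 2 * M / (1 + (t - r)) ^ 2, ?_, ?_⟩, ?_⟩
  · have h1 : HasDerivAt (fun r : ℝ => r ^ 2 * M) (2 * r * M) r := by
      simpa using (hasDerivAt_pow 2 r).mul_const M
    have h2 : HasDerivAt (fun r : ℝ => 1 + t - r) (-1) r := by
      simpa using (hasDerivAt_id r).const_sub (1 + t)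
    have h3 := h1.div h2 (by linarith)
    have e3 : (2 * r * M * (1 + t - r) - r ^ 2 * M * -1) / (1 + t - r) ^ 2 =
        2 * r * M / (1 + (t - r)) + r ^ 2 * M / (1 + (t - r)) ^ 2 := by
      rw [e]; field_simp; ring
    rw [e3] at h3
    exact h3
  · have : (1 / 2) * (r ^ 2 * (P * (1 + w))) ≤ r ^ 2 * M := by
      have : P * (1 + w) ≤ M * 2 := by nlinarith
      nlinarith [sq_nonneg r]
    have h2 : (1 / 2) * (r ^ 2 * (P * (1 + w))) / (1 + (t - r)) ^ 2 ≤ r ^ 2 * M / (1 + (t - r)) ^ 2 := by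
      gcongr
    have : 0 ≤ 2 * r * M / (1 + (t - r)) := by positivity
    linarith
  · rw [e]
    have : M ≤ 4 * (P * (1 + w)) := by nlinarith
    have : r ^ 2 * M ≤ 4 * (r ^ 2 * (P * (1 + w))) := by nlinarith [sq_nonneg r]
    gcongr

lemma lc_right (γ μ a t r : ℝ) (hγ : 0 < γ) (ha1 : -1 ≤ a) (ha2 : a ≤ 1) (ht : 0 ≤ t) (hr : 0 < r) (hrt : t ≤ r) :
    (∃ d, HasDerivAt (fun r => r ^ 2 * (1 + r) ^ (-(1 - a)) * (1 + (r - t)) ^ (2 * γ)) d r ∧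
      γ * (r ^ 2 * lcW γ μ a t r) / (1 + |r - t|) ^ 2 ≤ d) ∧
    r ^ 2 * (1 + r) ^ (-(1 - a)) * (1 + (r - t)) ^ (2 * γ) ≤ 4 * (r ^ 2 * lcW γ μ a t r) / (1 + |r - t|) := by
  have habs : |r - t| = r - t := abs_of_nonneg (by linarith)
  have hs : 1 ≤ 1 + (r - t) := by linarith
  have hs0 : 0 < 1 + (r - t) := by linarith
  have hW : lcW γ μ a t r = (1 + r) ^ (-(1 - a)) * (1 + (1 + (r - t)) ^ (1 + 2 * γ)) := by
    unfold lcW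
    rw [habs]
    split_ifs with h
    · ring_nf
    · have : r = t := by linarith
      simp [this]
  have hq1 : (1 + (r - t)) ^ (1 + 2 * γ) = (1 + (r - t)) * (1 + (r - t)) ^ (2 * γ) := by
    rw [rpow_add hs0, rpow_one]
  have hq2 : (1 + (r - t)) ^ (2 * γ - 1) = (1 + (r - t)) ^ (2 * γ) / (1 + (r - t)) := by
    rw [rpow_sub hs0, rpow_one]
  have hq3 : (1 + r) ^ (-(1 - a) - 1) = (1 + r) ^ (-(1 - a)) / (1 + r) := by
    rw [rpow_sub (by linarith), rpow_one]
  have hQ1 : 1 ≤ (1 + (r - t)) ^ (2 * γ) := one_le_rpow hs (by linarith)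
  have hM : 0 < (1 + r) ^ (-(1 - a)) := by apply rpow_pos_of_pos; linarith
  have hd1 : HasDerivAt (fun r : ℝ => (1 + r) ^ (-(1 - a))) (-(1 - a) * (1 + r) ^ (-(1 - a) - 1)) r := by
    have := ((hasDerivAt_id r).const_add 1).rpow_const (p := -(1 - a)) (Or.inl (by simp; linarith))
    simpa using this
  have hd2 : HasDerivAt (fun r : ℝ => (1 + (r - t)) ^ (2 * γ)) (2 * γ * (1 + (r - t)) ^ (2 * γ - 1)) r := by
    have := (((hasDerivAt_id r).sub_const t).const_add 1).rpow_const (p := 2 * γ) (Or.inl (by simp; linarith))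
    simpa using this
  have hd := ((hasDerivAt_pow 2 r).mul hd1).mul hd2
  rw [hq2, hq3] at hd
  rw [hW, habs, hq1]
  set M := (1 + r) ^ (-(1 - a))
  set Q := (1 + (r - t)) ^ (2 * γ)
  set s := 1 + (r - t)
  have hQ : 0 < Q := by linarith
  refine ⟨⟨_, hd, ?_⟩, ?_⟩
  · have k1 : γ * (r ^ 2 * (M * (1 + s * Q))) / s ^ 2 ≤ r ^ 2 * M * (2 * γ * (Q / s)) := by
      have : 1 ≤ s * Q := by nlinarith
      rw [div_le_iff₀ (by positivity)]
      have : r ^ 2 * M * (2 * γ * (Q / s)) * s ^ 2 = γ * (r ^ 2 * (M * (2 * (s * Q)))) := by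
        field_simp
      rw [this]
      gcongr
      linarith
    have k2 : 0 ≤ (2 * r * M + r ^ 2 * (-(1 - a) * (M / (1 + r)))) * Q := by
      have : 2 * r * M + r ^ 2 * (-(1 - a) * (M / (1 + r))) = r * M * (2 * (1 + r) - (1 - a) * r) / (1 + r) := by
        field_simp; ring
      rw [this]
      have : 0 ≤ 2 * (1 + r) - (1 - a) * r := by nlinarith
      positivity
    simp only [Nat.cast_ofNat, Nat.add_one_sub_one, pow_one, Pi.mul_apply, Pi.pow_apply] at *
    linarith
  · rw [le_div_iff₀ hs0]
    have : r ^ 2 * M * Q * s ≤ r ^ 2 * (M * (1 + s * Q)) := by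
      nlinarith [mul_nonneg (sq_nonneg r) hM.le]
    have : 0 ≤ r ^ 2 * (M * (1 + s * Q)) := by positivity
    linarith

lemma lcH_cont (γ a t : ℝ) (hγ : 0 < γ) (ht : 0 ≤ t) (R : ℝ) : ContinuousOn (lcH γ a t) (Set.Icc 0 R) := by
  -- pass to a globally continuous function
  have : Continuous fun r : ℝ => if r < t then r ^ 2 * (1 + t) ^ (-(1 - a)) / (1 + max (t - r) 0)
      else r ^ 2 * (1 + |r|) ^ (-(1 - a)) * (1 + |r - t|) ^ (2 * γ) := by
    refine Continuous.if ?_ ?_ ?_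
    · intro r hr
      have : r = t := by
        rw [show {r : ℝ | r < t} = Set.Iio t from rfl, frontier_Iio] at hr; exact hr
      subst this
      simp [abs_of_nonneg ht]
    · refine Continuous.div (by fun_prop) (by fun_prop) fun r => ?_
      have := le_max_right (t - r) 0
      positivity
    · refine Continuous.mul (Continuous.mul (by fun_prop) ?_) ?_
      · exact (by fun_prop : Continuous fun r : ℝ => 1 + |r|).rpow_const fun r => Or.inl (by positivity)
      · exact (by fun_prop : Continuous fun r : ℝ => 1 + |r - t|).rpow_const fun r => Or.inl (by positivity)
  refine this.continuousOn.congr fun r hr => ?_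
  unfold lcH
  dsimp only
  split_ifs with h
  · rw [max_eq_left (by linarith)]; ring_nf
  · rw [abs_of_nonneg hr.1, abs_of_nonneg (by linarith)]

lemma lc_alg (c W s h d f f' : ℝ) (hc : 0 < c) (hW : 0 ≤ W) (hs : 0 < s) (hh : 0 ≤ h)
    (h1 : h ≤ 4 * W / s) (h2 : c * W / s ^ 2 ≤ d) :
    (c / 2) * (f ^ 2 * (W / s ^ 2)) - (32 / c) * (f' ^ 2 * W) ≤ 2 * f * f' * h + f ^ 2 * d := by
  have a1 : f ^ 2 * (c * W / s ^ 2) ≤ f ^ 2 * d := by gcongr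
  have a2 : -(2 * f * f' * h) ≤ 2 * |f * f'| * (4 * W / s) := by
    have : -(2 * f * f' * h) ≤ 2 * |f * f'| * h := by
      have := neg_abs_le (f * f'); nlinarith
    refine this.trans ?_
    gcongr
  have a3 : 2 * |f * f'| * (4 * W / s) ≤ (c / 2) * (f ^ 2 * (W / s ^ 2)) + (32 / c) * (f' ^ 2 * W) := by
    rw [abs_mul, ← sq_abs f, ← sq_abs f']
    have : (c / 2) * (|f| ^ 2 * (W / s ^ 2)) + (32 / c) * (|f'| ^ 2 * W) - 2 * (|f| * |f'|) * (4 * W / s)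
      = (c / 2) * W * (|f| / s - 8 / c * |f'|) ^ 2 := by
      field_simp; ring
    have : 0 ≤ (c / 2) * W * (|f| / s - 8 / c * |f'|) ^ 2 := by positivity
    linarith
  have : f ^ 2 * (c * W / s ^ 2) = c * (f ^ 2 * (W / s ^ 2)) := by ring
  linarith

lemma lcH_nonneg (γ a t r : ℝ) (hr : 0 ≤ r) (ht : 0 ≤ t) : 0 ≤ lcH γ a t r := by
  unfold lcH
  split_ifs with h
  · have : 0 < 1 + t - r := by linarith
    positivity
  · have : 0 ≤ r - t := by linarith
    positivity

lemma lcH_deriv (γ μ a t c r : ℝ) (hγ : 0 < γ) (hμ : 0 < μ) (ha1 : -1 ≤ a) (ha2 : a ≤ 1)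
    (ht : 0 ≤ t) (hc1 : c ≤ 1 / 2) (hc2 : c ≤ γ) (hr : 0 < r) :
    (∃ d, HasDerivWithinAt (lcH γ a t) d (Set.Ioi r) r ∧
      c * (r ^ 2 * lcW γ μ a t r) / (1 + |r - t|) ^ 2 ≤ d) ∧
    lcH γ a t r ≤ 4 * (r ^ 2 * lcW γ μ a t r) / (1 + |r - t|) := by
  have hW : 0 ≤ r ^ 2 * lcW γ μ a t r := by have := lcW_nonneg γ μ a t r ht; positivity
  rcases lt_or_ge r t with h | h
  · obtain ⟨⟨d, hd, hd2⟩, h3⟩ := lc_left γ μ a t r hμ ha1 ha2 hr h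
    refine ⟨⟨d, ?_, le_trans (by gcongr) hd2⟩, ?_⟩
    · refine (hd.congr_of_eventuallyEq ?_).hasDerivWithinAt
      filter_upwards [Iio_mem_nhds h] with x hx
      exact if_pos hx
    · rw [lcH, if_pos h]; exact h3
  · obtain ⟨⟨d, hd, hd2⟩, h3⟩ := lc_right γ μ a t r hγ ha1 ha2 ht hr h
    refine ⟨⟨d, ?_, le_trans (by gcongr) hd2⟩, ?_⟩
    · refine hd.hasDerivWithinAt.congr ?_ ?_
      · intro x hx
        have hx : r < x := hx
        exact if_neg (by linarith)
      · exact if_neg (by linarith)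
    · rw [lcH, if_neg (by linarith)]; exact h3

lemma lc_oned (γ μ a t c R : ℝ) (hγ : 0 < γ) (hμ : 0 < μ) (ha1 : -1 ≤ a) (ha2 : a ≤ 1)
    (ht : 0 ≤ t) (hc : 0 < c) (hc1 : c ≤ 1 / 2) (hc2 : c ≤ γ) (hR : 0 ≤ R)
    (f f' : ℝ → ℝ) (hf : ∀ r, HasDerivAt f (f' r) r) (hf' : Continuous f') (hfR : f R = 0) :
    ∫ r in (0:ℝ)..R, ((c / 2) * (f r ^ 2 * ((r ^ 2 * lcW γ μ a t r) / (1 + |r - t|) ^ 2)) -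
      (32 / c) * (f' r ^ 2 * (r ^ 2 * lcW γ μ a t r))) ≤ 0 := by
  have hfc : Continuous f := continuous_iff_continuousAt.2 fun r => (hf r).continuousAt
  have hWc := lcW_cont γ μ a t ht
  have key : ∀ r, 0 < r → ∃ d, HasDerivWithinAt (lcH γ a t) d (Set.Ioi r) r ∧
      c * (r ^ 2 * lcW γ μ a t r) / (1 + |r - t|) ^ 2 ≤ d := fun r hr =>
    (lcH_deriv γ μ a t c r hγ hμ ha1 ha2 ht hc1 hc2 hr).1
  choose! d hd1 hd2 using key
  have := intervalIntegral.integral_le_sub_of_hasDeriv_right_of_le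
    (g := fun r => f r ^ 2 * lcH γ a t r) (g' := fun r => 2 * f r * f' r * lcH γ a t r + f r ^ 2 * d r)
    (φ := fun r => (c / 2) * (f r ^ 2 * ((r ^ 2 * lcW γ μ a t r) / (1 + |r - t|) ^ 2)) -
      (32 / c) * (f' r ^ 2 * (r ^ 2 * lcW γ μ a t r))) hR
    ((hfc.pow 2).continuousOn.mul (lcH_cont γ a t hγ ht R)) ?_ ?_ ?_
  · refine this.trans_eq ?_
    simp only [hfR]
    have : lcH γ a t 0 = 0 := by simp [lcH]
    simp [this]
  · intro r hr
    have h1 : HasDerivWithinAt (fun r => f r ^ 2) (2 * f r * f' r) (Set.Ioi r) r := by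
      simpa using ((hf r).fun_pow 2).hasDerivWithinAt
    exact h1.mul (hd1 r hr.1)
  · refine Continuous.integrableOn_Icc ?_
    have : ∀ r : ℝ, (1 + |r - t|) ^ 2 ≠ 0 := fun r => by positivity
    fun_prop (disch := assumption)
  · intro r hr
    refine lc_alg c _ (1 + |r - t|) _ _ _ _ hc ?_ (by positivity) (lcH_nonneg γ a t r hr.1.le ht)
      (lcH_deriv γ μ a t c r hγ hμ ha1 ha2 ht hc1 hc2 hr.1).2 (hd2 r hr.1)
    have := lcW_nonneg γ μ a t r ht
    positivity

/-- the Hardy-type inequality with weight singular on the light cone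
(first estimate of Corollary `cor:Poinc`). -/
theorem lightcone_hardy_corollary (γ μ a : ℝ) (hγ : 0 < γ) (hμ : 0 < μ)
    (ha1 : -1 ≤ a) (ha2 : a ≤ 1) :
    ∃ C > 0, ∀ t : ℝ, 0 ≤ t → ∀ φ : EuclideanSpace ℝ (Fin 3) → ℝ,
      ContDiff ℝ (⊤ : ℕ∞) φ → HasCompactSupport φ →
      (∫ x : EuclideanSpace ℝ (Fin 3),
          (φ x)^2 * (1 + |‖x‖ - t|) ^ (-(2:ℝ)) * (1 + t + |‖x‖ - t|) ^ (-(1 - a)) *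
          (if 0 < ‖x‖ - t then 1 + (1 + |‖x‖ - t|) ^ (1 + 2*γ)
            else 1 + (1 + |‖x‖ - t|) ^ (-(2*μ)))) ≤
      C * ∫ x : EuclideanSpace ℝ (Fin 3),
          ‖fderiv ℝ φ x‖^2 * (1 + t + |‖x‖ - t|) ^ (-(1 - a)) *
          (if 0 < ‖x‖ - t then 1 + (1 + |‖x‖ - t|) ^ (1 + 2*γ)
            else 1 + (1 + |‖x‖ - t|) ^ (-(2*μ))) := by
  obtain ⟨c, hc, hc1, hc2⟩ : ∃ c : ℝ, 0 < c ∧ c ≤ 1 / 2 ∧ c ≤ γ :=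
    ⟨min (1 / 2) γ, lt_min (by norm_num) hγ, min_le_left _ _, min_le_right _ _⟩
  refine ⟨64 / c ^ 2, by positivity, fun t ht φ hφ hsupp => ?_⟩
  have hWc := lcW_cont γ μ a t ht
  have hWn : Continuous fun x : EuclideanSpace ℝ (Fin 3) => lcW γ μ a t ‖x‖ :=
    hWc.comp continuous_norm
  have hφc : Continuous φ := hφ.continuous
  have hdc : Continuous (fderiv ℝ φ) := hφ.continuous_fderiv (by simp)
  have hne : ∀ r : ℝ, (1 + |r - t|) ^ 2 ≠ 0 := fun r => by positivity
  have eL : ∀ x : EuclideanSpace ℝ (Fin 3),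
      (φ x)^2 * (1 + |‖x‖ - t|) ^ (-(2:ℝ)) * (1 + t + |‖x‖ - t|) ^ (-(1 - a)) *
          (if 0 < ‖x‖ - t then 1 + (1 + |‖x‖ - t|) ^ (1 + 2*γ)
            else 1 + (1 + |‖x‖ - t|) ^ (-(2*μ))) =
      φ x ^ 2 * (lcW γ μ a t ‖x‖ / (1 + |‖x‖ - t|) ^ 2) := by
    intro x
    have : (1 + |‖x‖ - t|) ^ (-(2:ℝ)) = 1 / (1 + |‖x‖ - t|) ^ 2 := by
      rw [rpow_neg (by positivity), rpow_two, one_div]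
    rw [this, lcW]; ring
  have eR : ∀ x : EuclideanSpace ℝ (Fin 3),
      ‖fderiv ℝ φ x‖^2 * (1 + t + |‖x‖ - t|) ^ (-(1 - a)) *
          (if 0 < ‖x‖ - t then 1 + (1 + |‖x‖ - t|) ^ (1 + 2*γ)
            else 1 + (1 + |‖x‖ - t|) ^ (-(2*μ))) = ‖fderiv ℝ φ x‖ ^ 2 * lcW γ μ a t ‖x‖ := by
    intro x
    rw [lcW]; ring
  simp only [eL, eR]
  have iL : Integrable fun x : EuclideanSpace ℝ (Fin 3) =>
      φ x ^ 2 * (lcW γ μ a t ‖x‖ / (1 + |‖x‖ - t|) ^ 2) := by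
    refine Continuous.integrable_of_hasCompactSupport ?_ ?_
    · have : ∀ x : EuclideanSpace ℝ (Fin 3), (1 + |‖x‖ - t|) ^ 2 ≠ 0 := fun r => by positivity
      fun_prop (disch := assumption)
    · exact hsupp.mono fun x hx => by
        simp only [Function.mem_support] at hx ⊢
        intro h; simp [h] at hx
  have iR : Integrable fun x : EuclideanSpace ℝ (Fin 3) =>
      ‖fderiv ℝ φ x‖ ^ 2 * lcW γ μ a t ‖x‖ := by
    refine Continuous.integrable_of_hasCompactSupport (by fun_prop) ?_
    exact (hsupp.fderiv ℝ).mono fun x hx => by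
        simp only [Function.mem_support] at hx ⊢
        intro h; simp [h] at hx
  rw [← integral_const_mul, ← sub_nonneg, ← integral_sub (iR.const_mul _) iL]
  apply lc_polar_nonneg
  intro ω hω
  obtain ⟨R, hR0, hR⟩ : ∃ R : ℝ, 0 ≤ R ∧ ∀ x, R ≤ ‖x‖ → φ x = 0 ∧ fderiv ℝ φ x = 0 := by
    obtain ⟨R, hR⟩ := hsupp.isCompact.isBounded.subset_ball 0
    refine ⟨max R 0, le_max_right _ _, fun x hx => ?_⟩
    have hx' : x ∉ tsupport φ := fun h => by
      have := hR h
      rw [mem_ball_zero_iff] at this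
      have := le_max_left R 0
      linarith
    refine ⟨image_eq_zero_of_notMem_tsupport hx', ?_⟩
    by_contra h
    exact hx' (support_fderiv_subset ℝ h)
  have hn : ∀ r : ℝ, 0 ≤ r → ‖r • ω‖ = r := fun r hr => by
    rw [norm_smul, hω, mul_one, norm_of_nonneg hr]
  have hφd : ∀ r : ℝ, HasDerivAt (fun r : ℝ => φ (r • ω)) (fderiv ℝ φ (r • ω) ω) r := by
    intro r
    have h1 : HasFDerivAt φ (fderiv ℝ φ (r • ω)) (r • ω) :=
      (hφ.differentiable (by simp) _).hasFDerivAt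
    have h2 : HasDerivAt (fun r : ℝ => r • ω) ω r := by
      simpa using (hasDerivAt_id r).smul_const ω
    exact h1.comp_hasDerivAt r h2
  have hφd' : Continuous fun r : ℝ => fderiv ℝ φ (r • ω) ω := by fun_prop
  have main := lc_oned γ μ a t c R hγ hμ ha1 ha2 ht hc hc1 hc2 hR0 _ _ hφd hφd'
    (hR _ (hn R hR0).ge).1
  rw [setIntegral_eq_of_subset_of_forall_sdiff_eq_zero (s := Set.Ioc 0 R) measurableSet_Ioi
    Set.Ioc_subset_Ioi_self, ← intervalIntegral.integral_of_le hR0]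
  · have hcong : ∀ r ∈ Set.uIcc 0 R, r ^ 2 * (64 / c ^ 2 * (‖fderiv ℝ φ (r • ω)‖ ^ 2 * lcW γ μ a t ‖r • ω‖) -
        φ (r • ω) ^ 2 * (lcW γ μ a t ‖r • ω‖ / (1 + |‖r • ω‖ - t|) ^ 2)) =
        r ^ 2 * (64 / c ^ 2 * (‖fderiv ℝ φ (r • ω)‖ ^ 2 * lcW γ μ a t r) -
        φ (r • ω) ^ 2 * (lcW γ μ a t r / (1 + |r - t|) ^ 2)) := by
      intro r hr
      rw [Set.uIcc_of_le hR0] at hr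
      rw [hn r hr.1]
    rw [intervalIntegral.integral_congr hcong]
    have hmono := intervalIntegral.integral_mono_on (μ := volume) (a := 0) (b := R)
      (f := fun r => -(2 / c) * ((c / 2) * (φ (r • ω) ^ 2 * ((r ^ 2 * lcW γ μ a t r) / (1 + |r - t|) ^ 2)) -
      (32 / c) * ((fderiv ℝ φ (r • ω) ω) ^ 2 * (r ^ 2 * lcW γ μ a t r))))
      (g := fun r => r ^ 2 * (64 / c ^ 2 * (‖fderiv ℝ φ (r • ω)‖ ^ 2 * lcW γ μ a t r) -
        φ (r • ω) ^ 2 * (lcW γ μ a t r / (1 + |r - t|) ^ 2))) hR0 ?_ ?_ ?_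
    · refine le_trans ?_ hmono
      rw [intervalIntegral.integral_const_mul]
      have : 0 ≤ 2 / c := by positivity
      nlinarith
    · refine Continuous.intervalIntegrable ?_ _ _
      fun_prop (disch := assumption)
    · refine Continuous.intervalIntegrable ?_ _ _
      fun_prop (disch := assumption)
    · intro r hr
      have hW := lcW_nonneg γ μ a t r ht
      have h1 : (fderiv ℝ φ (r • ω) ω) ^ 2 ≤ ‖fderiv ℝ φ (r • ω)‖ ^ 2 := by
        have := (fderiv ℝ φ (r • ω)).le_opNorm ω
        rw [hω, mul_one] at this
        rw [← sq_abs, ← Real.norm_eq_abs]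
        gcongr
      have h2 : 64 / c ^ 2 * (r ^ 2 * lcW γ μ a t r) * (fderiv ℝ φ (r • ω) ω) ^ 2 ≤
        64 / c ^ 2 * (r ^ 2 * lcW γ μ a t r) * ‖fderiv ℝ φ (r • ω)‖ ^ 2 := by gcongr
      have e1 : -(2 / c) * ((c / 2) * (φ (r • ω) ^ 2 * ((r ^ 2 * lcW γ μ a t r) / (1 + |r - t|) ^ 2)) -
        (32 / c) * ((fderiv ℝ φ (r • ω) ω) ^ 2 * (r ^ 2 * lcW γ μ a t r))) =
        64 / c ^ 2 * (r ^ 2 * lcW γ μ a t r) * (fderiv ℝ φ (r • ω) ω) ^ 2 -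
        φ (r • ω) ^ 2 * ((r ^ 2 * lcW γ μ a t r) / (1 + |r - t|) ^ 2) := by
        field_simp; ring
      rw [e1]
      refine (sub_le_sub_right h2 _).trans_eq ?_
      ring
  · intro r hr
    have h0 : 0 < r := hr.1
    have h1 : R ≤ r := by
      by_contra h
      exact hr.2 ⟨h0, by linarith⟩
    have := hR (r • ω) (by rw [hn r h0.le]; exact h1)
    simp [this.1, this.2]
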